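/- Characterisation of reachability at finite types: for a finite type α, (1) the logical equivalence x:α ↪ y ≡ ∃i. reach_i(x, y) is valid, where reach_i is the i-step reachability predicate; (2) the inductive predicate reachB satisfies reachB(x:α, y) ≡ ∃i. reach_i(x, y) validly; consequently x:α ↪ y ≡ reachB(x, y) is valid, so at finite types the reachability predicate ↪ is completely characterised by the inductive axioms: reachB(x:C, y) ≡ F for base types C; reachB(x:α₁×α₂, y) ≡ ∃x₁,x₂.(x = ⟨x₁,x₂⟩ ∧ (reachB(x₁,y) ∨ reachB(x₂,y))); reachB(x:α₁+α₂, y) ≡ ∃x'.((x = inj₁(x') ∨ x = inj₂(x')) ∧ reachB(x',y)); reachB(x:ref(α), y) ≡ (x = y ∨ reachB(!x, y)). -/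

import Mathlib

/-!
Characterisation of reachability at finite types (Propositions A, B and the
Corollary in Appendix `elimination` of Yoshida–Honda–Berger, "Logical
Reasoning for Higher-Order Functions with Local State").

Finite types (built from unit, Bool, Nat, products, sums and references
only), their values and the i-step reachability predicate reach_i and the
inductive predicate reachB are concretely embedded.  The semantic
reachability x ↪ y is membership of the location y in the label closure of
the free locations of the value of x in the store.  Validity in every model
is expressed by quantifying over all (well-typed) stores and values.
-/

namespace FiniteReach

/-- Finite types. -/
inductive FTy : Type
  | unit : FTy
  | bool : FTy
  | nat : FTy
  | prod : FTy → FTy → FTy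
  | sum : FTy → FTy → FTy
  | ref : FTy → FTy

/-- Values of finite types. -/
inductive FVal (Loc : Type) : Type
  | unit : FVal Loc
  | tt : FVal Loc
  | ff : FVal Loc
  | nat : ℕ → FVal Loc
  | pair : FVal Loc → FVal Loc → FVal Loc
  | inl : FVal Loc → FVal Loc
  | inr : FVal Loc → FVal Loc
  | loc : Loc → FVal Loc

/-- Typing of values: Δ gives the content type of each location. -/
inductive HasTy {Loc : Type} (Δ : Loc → FTy) : FVal Loc → FTy → Prop
  | unit : HasTy Δ .unit .unit
  | tt : HasTy Δ .tt .bool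
  | ff : HasTy Δ .ff .bool
  | nat (n : ℕ) : HasTy Δ (.nat n) .nat
  | pair {a b α β} : HasTy Δ a α → HasTy Δ b β → HasTy Δ (.pair a b) (.prod α β)
  | inl {a α} (β : FTy) : HasTy Δ a α → HasTy Δ (.inl a) (.sum α β)
  | inr {b β} (α : FTy) : HasTy Δ b β → HasTy Δ (.inr b) (.sum α β)
  | loc (l : Loc) : HasTy Δ (.loc l) (.ref (Δ l))

/-- The free locations of a value. -/
def FVal.fl {Loc : Type} : FVal Loc → Set Loc
  | .unit => ∅
  | .tt => ∅
  | .ff => ∅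
  | .nat _ => ∅
  | .pair a b => a.fl ∪ b.fl
  | .inl a => a.fl
  | .inr b => b.fl
  | .loc l => {l}

/-- The label closure of a set of locations in the store σ. -/
def labelClosure {Loc : Type} (σ : Loc → FVal Loc) (S : Set Loc) : Set Loc :=
  ⋂₀ {S' : Set Loc | S ⊆ S' ∧ ∀ l ∈ S', (σ l).fl ⊆ S'}

/-- The i-step reachability predicate reach_i(x, y): the reference y is
reachable from the value of x in at most i steps.
reach_0(x, y) ≡ x = y; reach_{n+1}(x : C, y) ≡ F for base types C;
reach_{n+1}(x : α₁×α₂, y) ≡ reach_n(π₁ x, y) ∨ reach_n(π₂ x, y) ∨ reach_n(x, y);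
reach_{n+1}(x : α₁+α₂, y) ≡ ∃x'.(x = inj₁ x' ∧ reach_n(x', y)) ∨
  ∃x'.(x = inj₂ x' ∧ reach_n(x', y)) ∨ reach_n(x, y);
reach_{n+1}(x : ref α, y) ≡ reach_n(!x, y) ∨ reach_n(x, y). -/
def iReach {Loc : Type} (σ : Loc → FVal Loc) : ℕ → FVal Loc → Loc → Prop
  | 0, v, l => v = FVal.loc l
  | _ + 1, FVal.unit, _ => False
  | _ + 1, FVal.tt, _ => False
  | _ + 1, FVal.ff, _ => False
  | _ + 1, FVal.nat _, _ => False
  | n + 1, FVal.pair a b, l =>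
      iReach σ n a l ∨ iReach σ n b l ∨ iReach σ n (FVal.pair a b) l
  | n + 1, FVal.inl a, l =>
      (∃ a', FVal.inl a = FVal.inl a' ∧ iReach σ n a' l)
        ∨ iReach σ n (FVal.inl a) l
  | n + 1, FVal.inr b, l =>
      (∃ b', FVal.inr b = FVal.inr b' ∧ iReach σ n b' l)
        ∨ iReach σ n (FVal.inr b) l
  | n + 1, FVal.loc l', l =>
      iReach σ n (σ l') l ∨ iReach σ n (FVal.loc l') l

/-- The inductive reachability predicate reachB, given by the axioms:
reachB(x : C, y) ≡ F for base C;
reachB(x : α₁×α₂, y) ≡ ∃x₁x₂.(x = ⟨x₁,x₂⟩ ∧ (reachB(x₁,y) ∨ reachB(x₂,y)));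
reachB(x : α₁+α₂, y) ≡ ∃x'.((x = inj₁ x' ∨ x = inj₂ x') ∧ reachB(x',y));
reachB(x : ref α, y) ≡ (x = y ∨ reachB(!x, y)). -/
inductive ReachB {Loc : Type} (σ : Loc → FVal Loc) : FVal Loc → Loc → Prop
  | pairL {a b l} : ReachB σ a l → ReachB σ (.pair a b) l
  | pairR {a b l} : ReachB σ b l → ReachB σ (.pair a b) l
  | inl {a l} : ReachB σ a l → ReachB σ (.inl a) l
  | inr {b l} : ReachB σ b l → ReachB σ (.inr b) l
  | here (l : Loc) : ReachB σ (.loc l) l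
  | deref {l' l} : ReachB σ (σ l') l → ReachB σ (.loc l') l

theorem ReachB.of_iReach {Loc : Type} {σ : Loc → FVal Loc} {i : ℕ} {v : FVal Loc} {l : Loc}
    (h : iReach σ i v l) : ReachB σ v l := by
  induction i generalizing v with
  | zero =>
    simp only [iReach] at h
    exact h ▸ .here l
  | succ n ih =>
    cases v with
    | unit | tt | ff | nat => exact h.elim
    | pair a b =>
      rcases h with h | h | h
      exacts [.pairL (ih h), .pairR (ih h), ih h]
    | inl a =>
      rcases h with ⟨_, ⟨⟩, h⟩ | h
      exacts [.inl (ih h), ih h]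
    | inr b =>
      rcases h with ⟨_, ⟨⟩, h⟩ | h
      exacts [.inr (ih h), ih h]
    | loc l' =>
      rcases h with h | h
      exacts [.deref (ih h), ih h]

theorem ReachB.exists_iReach {Loc : Type} {σ : Loc → FVal Loc} {v : FVal Loc} {l : Loc}
    (h : ReachB σ v l) : ∃ i : ℕ, iReach σ i v l := by
  induction h with
  | pairL _ ih => exact ih.imp' Nat.succ fun _ h => Or.inl h
  | pairR _ ih => exact ih.imp' Nat.succ fun _ h => Or.inr (Or.inl h)
  | inl _ ih => exact ih.imp' Nat.succ fun _ h => Or.inl ⟨_, rfl, h⟩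
  | inr _ ih => exact ih.imp' Nat.succ fun _ h => Or.inl ⟨_, rfl, h⟩
  | here l => exact ⟨0, by simp only [iReach]⟩
  | deref _ ih => exact ih.imp' Nat.succ fun _ h => Or.inl h

theorem reachB_iff_exists_iReach {Loc : Type} {σ : Loc → FVal Loc} {v : FVal Loc} {l : Loc} :
    ReachB σ v l ↔ ∃ i : ℕ, iReach σ i v l :=
  ⟨ReachB.exists_iReach, fun ⟨_, h⟩ => .of_iReach h⟩

theorem ReachB.trans {Loc : Type} {σ : Loc → FVal Loc} {v : FVal Loc} {l m : Loc}
    (h : ReachB σ v l) (hm : ReachB σ (σ l) m) : ReachB σ v m := by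
  induction h with
  | pairL _ ih => exact .pairL (ih hm)
  | pairR _ ih => exact .pairR (ih hm)
  | inl _ ih => exact .inl (ih hm)
  | inr _ ih => exact .inr (ih hm)
  | here l => exact .deref hm
  | deref _ ih => exact .deref (ih hm)

theorem ReachB.of_mem_fl {Loc : Type} {σ : Loc → FVal Loc} {v : FVal Loc} {l : Loc}
    (h : l ∈ v.fl) : ReachB σ v l := by
  induction v with
  | unit | tt | ff | nat => exact h.elim
  | pair a b iha ihb => exact h.elim (fun h => .pairL (iha h)) fun h => .pairR (ihb h)
  | inl a ih => exact .inl (ih h)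
  | inr b ih => exact .inr (ih h)
  | loc l' =>
    obtain rfl : l = l' := h
    exact .here l

theorem ReachB.mem_of_closed {Loc : Type} {σ : Loc → FVal Loc} {v : FVal Loc} {l : Loc}
    (h : ReachB σ v l) {S : Set Loc} (hv : v.fl ⊆ S) (hS : ∀ l ∈ S, (σ l).fl ⊆ S) : l ∈ S := by
  induction h with
  | pairL _ ih => exact ih (Set.subset_union_left.trans hv)
  | pairR _ ih => exact ih (Set.subset_union_right.trans hv)
  | inl _ ih => exact ih hv
  | inr _ ih => exact ih hv
  | here l => exact hv rfl
  | deref _ ih => exact ih (hS _ (hv rfl))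

theorem mem_labelClosure_iff_reachB {Loc : Type} {σ : Loc → FVal Loc} {v : FVal Loc} {l : Loc} :
    l ∈ labelClosure σ v.fl ↔ ReachB σ v l :=
  ⟨fun h => h {m | ReachB σ v m}
      ⟨fun _ => .of_mem_fl, fun _ hl _ hm => ReachB.trans hl (.of_mem_fl hm)⟩,
    fun h _ hS => h.mem_of_closed hS.1 hS.2⟩

theorem reachability_at_finite_types
    (Loc : Type)
    (Δ : Loc → FTy)
    (σ : Loc → FVal Loc)
    -- the store is well-typed
    (hσ : ∀ l : Loc, HasTy Δ (σ l) (Δ l)) :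
    -- (1) x : α ↪ y ≡ ∃i. reach_i(x, y)
    ( ∀ (α : FTy) (v : FVal Loc) (l : Loc), HasTy Δ v α →
        (l ∈ labelClosure σ v.fl ↔ ∃ i : ℕ, iReach σ i v l) )
    ∧
    -- (2) reachB(x : α, y) ≡ ∃i. reach_i(x, y)
    ( ∀ (α : FTy) (v : FVal Loc) (l : Loc), HasTy Δ v α →
        (ReachB σ v l ↔ ∃ i : ℕ, iReach σ i v l) )
    ∧
    -- consequently x : α ↪ y ≡ reachB(x, y): at finite types ↪ is completely
    -- characterised by the inductive axioms for reachB
    ( ∀ (α : FTy) (v : FVal Loc) (l : Loc), HasTy Δ v α →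
        (l ∈ labelClosure σ v.fl ↔ ReachB σ v l) ) :=
  ⟨fun _ _ _ _ => mem_labelClosure_iff_reachB.trans reachB_iff_exists_iReach,
    fun _ _ _ _ => reachB_iff_exists_iReach,
    fun _ _ _ _ => mem_labelClosure_iff_reachB⟩

end FiniteReach
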